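/- Let f : ℝⁿ → [0,1] be Borel measurable. Then for every t > 0 and every x ∈ ℝⁿ, the reverse isoperimetric inequality (e^{2t} − 1) |∇Q_t f(x)|² ≤ I_γ(Q_t f(x))² − (Q_t(I_γ ∘ f)(x))² holds. In particular, the function Φ⁻¹ ∘ Q_t f satisfies |∇(Φ⁻¹ ∘ Q_t f)(x)|² ≤ 1/(e^{2t} − 1) for all x. -/

import Mathlib

open MeasureTheory

/-- Standard Gaussian density `φ` on `ℝ`. -/
noncomputable def gaussPdf (x : ℝ) : ℝ := (Real.sqrt (2 * Real.pi))⁻¹ * Real.exp (-(x ^ 2) / 2)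

/-- Standard Gaussian cumulative distribution function `Φ`. -/
noncomputable def gaussCdf (x : ℝ) : ℝ := ∫ t in Set.Iic x, gaussPdf t

/-- Inverse of the Gaussian cdf (quantile function `Φ⁻¹`). -/
noncomputable def gaussQuantile : ℝ → ℝ := Function.invFun gaussCdf

/-- Gaussian isoperimetric profile `I_γ`: `I_γ(v) = φ(Φ⁻¹(v))` on `(0,1)`, `0` at the endpoints. -/
noncomputable def Igauss (v : ℝ) : ℝ :=
  if v = 0 ∨ v = 1 then 0 else gaussPdf (gaussQuantile v)

abbrev En (n : ℕ) := EuclideanSpace ℝ (Fin n)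

/-- Standard Gaussian probability measure `γₙ` on `ℝⁿ`. -/
noncomputable def gaussE (n : ℕ) : Measure (En n) :=
  volume.withDensity (fun x =>
    ENNReal.ofReal ((2 * Real.pi) ^ (-(n : ℝ) / 2) * Real.exp (-‖x‖ ^ 2 / 2)))

/-- Ornstein–Uhlenbeck semigroup `Q_t`. -/
noncomputable def ou (n : ℕ) (t : ℝ) (f : En n → ℝ) (x : En n) : ℝ :=
  ∫ y, f (Real.exp (-t) • x + Real.sqrt (1 - Real.exp (-2 * t)) • y) ∂(gaussE n)

open ProbabilityTheory Filter Topology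

lemma gaussPdf_eq_gaussianPDFReal : gaussPdf = gaussianPDFReal 0 1 := by
  ext x
  simp [gaussPdf, gaussianPDFReal]

lemma gaussPdf_pos (x : ℝ) : 0 < gaussPdf x := by
  rw [gaussPdf_eq_gaussianPDFReal]
  exact gaussianPDFReal_pos 0 1 x one_ne_zero

lemma gaussPdf_le_one (x : ℝ) : gaussPdf x ≤ 1 := by
  have h1 : (Real.sqrt (2 * Real.pi))⁻¹ ≤ 1 := by
    refine inv_le_one_of_one_le₀ (Real.one_le_sqrt.2 ?_)
    linarith [Real.pi_gt_three]
  have h2 : Real.exp (-(x ^ 2) / 2) ≤ 1 := Real.exp_le_one_iff.2 (by nlinarith [sq_nonneg x])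
  exact mul_le_one₀ h1 (Real.exp_pos _).le h2

lemma gaussPdf_neg (x : ℝ) : gaussPdf (-x) = gaussPdf x := by
  simp [gaussPdf]

lemma continuous_gaussPdf : Continuous gaussPdf := by
  unfold gaussPdf
  fun_prop

lemma integrable_gaussPdf : Integrable gaussPdf := by
  rw [gaussPdf_eq_gaussianPDFReal]
  exact integrable_gaussianPDFReal 0 1

lemma hasDerivAt_gaussPdf (x : ℝ) : HasDerivAt gaussPdf (-(x * gaussPdf x)) x := by
  have h : HasDerivAt (fun y : ℝ => -(y ^ 2) / 2) (-x) x := by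
    convert! ((hasDerivAt_pow 2 x).neg.div_const 2) using 1
    simp only [Nat.cast_ofNat]
    ring
  convert! h.exp.const_mul (Real.sqrt (2 * Real.pi))⁻¹ using 1
  simp only [gaussPdf]
  ring

lemma gaussCdf_eq_measureReal (x : ℝ) : gaussCdf x = (gaussianReal 0 1).real (Set.Iic x) := by
  rw [measureReal_def, gaussianReal_apply_eq_integral 0 one_ne_zero, ENNReal.toReal_ofReal]
  · rw [gaussCdf, gaussPdf_eq_gaussianPDFReal]
  · exact integral_nonneg fun y => gaussianPDFReal_nonneg 0 1 y

lemma hasDerivAt_gaussCdf (x : ℝ) : HasDerivAt gaussCdf (gaussPdf x) x := by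
  have h : gaussCdf = fun y => gaussCdf 0 + ∫ s in (0 : ℝ)..y, gaussPdf s := by
    ext y
    rw [← intervalIntegral.integral_Iic_sub_Iic integrable_gaussPdf.integrableOn
      integrable_gaussPdf.integrableOn]
    simp [gaussCdf]
  rw [h]
  exact (intervalIntegral.integral_hasDerivAt_right
    (continuous_gaussPdf.intervalIntegrable _ _)
    continuous_gaussPdf.stronglyMeasurable.stronglyMeasurableAtFilter
    continuous_gaussPdf.continuousAt).const_add _

lemma continuous_gaussCdf : Continuous gaussCdf :=
  continuous_iff_continuousAt.2 fun x => (hasDerivAt_gaussCdf x).continuousAt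

lemma strictMono_gaussCdf : StrictMono gaussCdf :=
  strictMono_of_hasDerivAt_pos hasDerivAt_gaussCdf gaussPdf_pos

lemma gaussCdf_gaussQuantile {v : ℝ} (h0 : 0 < v) (h1 : v < 1) :
    gaussCdf (gaussQuantile v) = v := by
  have h : gaussCdf = cdf (gaussianReal 0 1) := by
    ext x
    rw [gaussCdf_eq_measureReal, cdf_eq_real]
  refine Function.invFun_eq ?_
  refine mem_range_of_exists_le_of_exists_ge continuous_gaussCdf ?_ ?_
  · obtain ⟨a, ha⟩ := ((tendsto_cdf_atBot (gaussianReal 0 1)).eventually_lt_const h0).exists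
    exact ⟨a, h ▸ ha.le⟩
  · obtain ⟨a, ha⟩ := ((tendsto_cdf_atTop (gaussianReal 0 1)).eventually_const_lt h1).exists
    exact ⟨a, h ▸ ha.le⟩

lemma measurable_gaussQuantile : Measurable gaussQuantile := by
  have he := continuous_gaussCdf.measurableEmbedding strictMono_gaussCdf.injective
  convert! he.measurable_invFun using 1
  ext y
  by_cases hy : ∃ x, gaussCdf x = y
  · obtain ⟨x, rfl⟩ := hy
    rw [he.leftInverse_invFun, gaussQuantile,
      Function.leftInverse_invFun strictMono_gaussCdf.injective]
  · rw [gaussQuantile, Function.invFun_neg hy, MeasurableEmbedding.invFun,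
      dif_neg (show y ∉ Set.range gaussCdf from hy)]

lemma measurable_Igauss : Measurable Igauss :=
  Measurable.ite ((measurableSet_singleton 0).union (measurableSet_singleton 1))
    measurable_const (continuous_gaussPdf.measurable.comp measurable_gaussQuantile)

lemma Igauss_nonneg (v : ℝ) : 0 ≤ Igauss v := by
  unfold Igauss
  split_ifs
  exacts [le_rfl, (gaussPdf_pos _).le]

lemma Igauss_le_one (v : ℝ) : Igauss v ≤ 1 := by
  unfold Igauss
  split_ifs
  exacts [zero_le_one, gaussPdf_le_one _]

lemma Igauss_eq {v : ℝ} (h0 : 0 < v) (h1 : v < 1) : Igauss v = gaussPdf (gaussQuantile v) := by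
  simp [Igauss, h0.ne', h1.ne]

lemma integrable_id_gaussianReal : Integrable (fun z : ℝ => z) (gaussianReal 0 1) :=
  IsGaussian.integrable_id

lemma gaussianReal_real_Ioi_neg (q : ℝ) :
    (gaussianReal 0 1).real (Set.Ioi (-q)) = gaussCdf q := by
  have : NullSingletonClass (gaussianReal 0 1) := nullSingletonClass_gaussianReal one_ne_zero
  have h : (gaussianReal 0 1).map (fun x => -x) = gaussianReal 0 1 := by
    rw [gaussianReal_map_neg, neg_zero]
  rw [gaussCdf_eq_measureReal, ← measureReal_congr (Iio_ae_eq_Iic (a := q)), ← h,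
    map_measureReal_apply measurable_neg measurableSet_Ioi, h]
  congr 1
  ext x
  simp

lemma setIntegral_Ioi_id_gaussianReal (a : ℝ) :
    ∫ z in Set.Ioi a, z ∂(gaussianReal 0 1) = gaussPdf a := by
  have hint : Integrable (fun z => z * gaussPdf z) := by
    have h := integrable_id_gaussianReal
    rw [gaussianReal_of_var_ne_zero 0 one_ne_zero, gaussianPDF_def,
      integrable_withDensity_iff_integrable_smul₀' (by fun_prop) (by simp)] at h
    refine h.congr (.of_forall fun z => ?_)
    simp only [ENNReal.toReal_ofReal (gaussianPDFReal_nonneg 0 1 z), smul_eq_mul,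
      gaussPdf_eq_gaussianPDFReal]
    ring
  have hlim : Tendsto (fun z => -gaussPdf z) atTop (𝓝 0) := by
    have h : Tendsto (fun z : ℝ => -(z ^ 2) / 2) atTop atBot := by
      simp_rw [neg_div]
      exact tendsto_neg_atTop_atBot.comp
        ((tendsto_pow_atTop two_ne_zero).atTop_div_const two_pos)
    simpa [gaussPdf] using
      ((Real.tendsto_exp_atBot.comp h).const_mul (Real.sqrt (2 * Real.pi))⁻¹).neg
  have hftc := integral_Ioi_of_hasDerivAt_of_tendsto' (a := a)
    (fun z _ => (hasDerivAt_gaussPdf z).neg) (by simpa using hint.integrableOn) hlim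
  rw [← integral_indicator measurableSet_Ioi,
    integral_gaussianReal_eq_integral_smul one_ne_zero]
  simp only [neg_neg, zero_sub, Pi.neg_apply] at hftc
  rw [← hftc, ← integral_indicator measurableSet_Ioi]
  refine integral_congr_ae (.of_forall fun z => ?_)
  by_cases hz : z ∈ Set.Ioi a
  · simp [hz, gaussPdf_eq_gaussianPDFReal, mul_comm]
  · simp [hz]

/-- Bathtub principle: among events of Gaussian probability `v`, half-lines maximise the mean. -/
lemma mul_add_mul_Igauss_le_integral {v : ℝ} (hv : v ∈ Set.Icc (0 : ℝ) 1) (c b : ℝ) :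
    v * c + b * Igauss v ≤ ∫ z, max (c + b * z) 0 ∂(gaussianReal 0 1) := by
  have hlin : Integrable (fun z => c + b * z) (gaussianReal 0 1) :=
    (integrable_const c).add (integrable_id_gaussianReal.const_mul b)
  rcases hv.1.eq_or_lt with rfl | h0
  · simpa [Igauss] using integral_nonneg fun z => le_max_right (c + b * z) 0
  rcases hv.2.eq_or_lt with rfl | h1
  · have h : ∫ z, (c + b * z) ∂(gaussianReal 0 1) = c := by
      rw [integral_add (integrable_const c) (integrable_id_gaussianReal.const_mul b),
        integral_const_mul, integral_id_gaussianReal]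
      simp
    simpa [Igauss, h] using integral_mono hlin hlin.pos_part fun z => le_max_left (c + b * z) 0
  · have h : ∫ z in Set.Ioi (-gaussQuantile v), (c + b * z) ∂(gaussianReal 0 1)
        = v * c + b * Igauss v := by
      rw [integral_add (integrable_const c) (integrable_id_gaussianReal.const_mul b).integrableOn,
        integral_const_mul, setIntegral_Ioi_id_gaussianReal, setIntegral_const,
        gaussianReal_real_Ioi_neg, gaussCdf_gaussQuantile h0 h1, gaussPdf_neg, Igauss_eq h0 h1,
        smul_eq_mul]
    rw [← h]
    calc _ ≤ ∫ z in Set.Ioi (-gaussQuantile v), max (c + b * z) 0 ∂(gaussianReal 0 1) :=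
          integral_mono hlin.integrableOn hlin.pos_part.integrableOn
            fun z => le_max_left (c + b * z) 0
      _ ≤ _ := setIntegral_le_integral hlin.pos_part (.of_forall fun z => le_max_right _ _)

lemma integral_pos_part_add_gaussQuantile {v : ℝ} (h0 : 0 < v) (h1 : v < 1) :
    ∫ z, max (z + gaussQuantile v) 0 ∂(gaussianReal 0 1)
      = Igauss v + gaussQuantile v * v := by
  set q := gaussQuantile v
  have h : (fun z => max (z + q) 0) = (Set.Ioi (-q)).indicator fun z => z + q := by
    ext z
    by_cases hz : z ∈ Set.Ioi (-q)
    · rw [Set.indicator_of_mem hz, max_eq_left (by linarith [Set.mem_Ioi.1 hz])]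
    · rw [Set.indicator_of_notMem hz, max_eq_right (by linarith [not_lt.1 (mt Set.mem_Ioi.2 hz)])]
  rw [h, integral_indicator measurableSet_Ioi,
    integral_add integrable_id_gaussianReal.integrableOn (integrable_const q),
    setIntegral_Ioi_id_gaussianReal, setIntegral_const, gaussianReal_real_Ioi_neg,
    gaussCdf_gaussQuantile h0 h1, gaussPdf_neg, Igauss_eq h0 h1, smul_eq_mul, mul_comm v]

open scoped RealInnerProductSpace

section GaussianMeasure

variable {n : ℕ}

lemma gaussE_density_integral :
    ∫ x : En n, (2 * Real.pi) ^ (-(n : ℝ) / 2) * Real.exp (-‖x‖ ^ 2 / 2) = 1 := by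
  have h := GaussianFourier.integral_rexp_neg_mul_sq_norm (V := En n) (b := 1 / 2) (by norm_num)
  rw [integral_const_mul]
  have h' : ∀ x : En n, -‖x‖ ^ 2 / 2 = -(1 / 2) * ‖x‖ ^ 2 := fun x => by ring
  simp_rw [h']
  rw [h, finrank_euclideanSpace_fin, show Real.pi / (1 / 2) = 2 * Real.pi by ring,
    ← Real.rpow_add (by positivity), neg_div, neg_add_cancel, Real.rpow_zero]

lemma gaussE_density_integrable :
    Integrable fun x : En n => (2 * Real.pi) ^ (-(n : ℝ) / 2) * Real.exp (-‖x‖ ^ 2 / 2) :=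
  .of_integral_ne_zero (gaussE_density_integral.trans_ne one_ne_zero)

lemma integral_gaussE {F : Type*} [NormedAddCommGroup F] [NormedSpace ℝ F] (h : En n → F) :
    ∫ x, h x ∂(gaussE n)
      = ∫ x, ((2 * Real.pi) ^ (-(n : ℝ) / 2) * Real.exp (-‖x‖ ^ 2 / 2)) • h x := by
  rw [gaussE, integral_withDensity_eq_integral_toReal_smul (by fun_prop) (by simp)]
  refine integral_congr_ae (.of_forall fun x => ?_)
  simp only
  rw [ENNReal.toReal_ofReal (by positivity)]

lemma gaussE_eq_stdGaussian : gaussE n = stdGaussian (En n) := by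
  have : IsFiniteMeasure (gaussE n) :=
    isFiniteMeasure_withDensity_ofReal gaussE_density_integrable.2
  refine Measure.ext_of_charFun (funext fun w => ?_)
  rw [charFun_stdGaussian, charFun_apply, integral_gaussE]
  have h := GaussianFourier.integral_cexp_neg_mul_sq_norm_add (V := En n) (b := 1 / 2)
    (by norm_num) Complex.I w
  have h' : ∀ x : En n, ((2 * Real.pi) ^ (-(n : ℝ) / 2) * Real.exp (-‖x‖ ^ 2 / 2)) •
      Complex.exp (⟪x, w⟫ * Complex.I) = ((2 * Real.pi) ^ (-(n : ℝ) / 2) : ℝ) *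
        Complex.exp (-(1 / 2) * ‖x‖ ^ 2 + Complex.I * ⟪w, x⟫) := fun x => by
    rw [Complex.real_smul, Complex.ofReal_mul, mul_assoc, Complex.ofReal_exp, ← Complex.exp_add,
      real_inner_comm]
    congr 2
    push_cast
    ring
  simp_rw [h']
  rw [integral_const_mul, h, finrank_euclideanSpace_fin, ← mul_assoc,
    show (Real.pi / (1 / 2) : ℂ) = ((2 * Real.pi : ℝ) : ℂ) by push_cast; ring,
    show (n / 2 : ℂ) = ((n / 2 : ℝ) : ℂ) by push_cast; ring,
    ← Complex.ofReal_cpow (by positivity), ← Complex.ofReal_mul, ← Real.rpow_add (by positivity),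
    neg_div, neg_add_cancel, Real.rpow_zero, Complex.ofReal_one, one_mul, Complex.I_sq]
  congr 1
  ring

instance isGaussian_gaussE : IsGaussian (gaussE n) := by
  rw [gaussE_eq_stdGaussian]
  infer_instance

lemma integrable_inner_gaussE (u : En n) : Integrable (fun y => ⟪u, y⟫) (gaussE n) :=
  IsGaussian.integrable_dual (gaussE n) (innerSL ℝ u)

lemma map_inner_gaussE (u : En n) :
    (gaussE n).map (fun y => ⟪u, y⟫) = gaussianReal 0 (‖u‖ ^ 2).toNNReal := by
  have h := IsGaussian.map_eq_gaussianReal (μ := gaussE n) (innerSL ℝ u)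
  rw [gaussE_eq_stdGaussian, integral_strongDual_stdGaussian, variance_dual_stdGaussian,
    innerSL_apply_norm] at h
  rw [gaussE_eq_stdGaussian]
  exact h

/-- Cameron–Martin formula for the standard Gaussian measure. -/
lemma integral_add_gaussE (h : En n → ℝ) (w : En n) :
    ∫ y, h (y + w) ∂(gaussE n) = ∫ y, h y * Real.exp (⟪w, y⟫ - ‖w‖ ^ 2 / 2) ∂(gaussE n) := by
  rw [integral_gaussE, integral_gaussE]
  refine Eq.trans ?_ (integral_add_right_eq_self _ w)
  refine integral_congr_ae (.of_forall fun y => ?_)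
  have h1 : Real.exp (-‖y‖ ^ 2 / 2)
      = Real.exp (-‖y + w‖ ^ 2 / 2) * Real.exp (⟪w, y + w⟫ - ‖w‖ ^ 2 / 2) := by
    rw [← Real.exp_add, norm_add_sq_real, inner_add_right, real_inner_self_eq_norm_sq,
      real_inner_comm w y]
    congr 1
    ring
  simp only [smul_eq_mul, h1]
  ring

lemma integrable_of_mem_Icc {g : En n → ℝ} (hg : Measurable g)
    (h01 : ∀ y, g y ∈ Set.Icc (0 : ℝ) 1) : Integrable g (gaussE n) :=
  .of_bound hg.aestronglyMeasurable 1 (.of_forall fun y => by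
    rw [Real.norm_of_nonneg (h01 y).1]; exact (h01 y).2)

lemma integrable_Igauss_comp {g : En n → ℝ} (hg : Measurable g) :
    Integrable (fun y => Igauss (g y)) (gaussE n) :=
  integrable_of_mem_Icc (measurable_Igauss.comp hg) fun _ => ⟨Igauss_nonneg _, Igauss_le_one _⟩

lemma integrable_mul_inner {g : En n → ℝ} (hg : Measurable g)
    (h01 : ∀ y, g y ∈ Set.Icc (0 : ℝ) 1) (u : En n) :
    Integrable (fun y => g y * ⟪u, y⟫) (gaussE n) :=
  (integrable_inner_gaussE u).bdd_mul (c := 1) hg.aestronglyMeasurable (.of_forall fun y => by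
    rw [Real.norm_of_nonneg (h01 y).1]; exact (h01 y).2)

lemma map_inner_add_gaussE_prod (u : En n) (b : ℝ) :
    ((gaussE n).prod (gaussianReal 0 1)).map (fun p => ⟪u, p.1⟫ + b * p.2)
      = gaussianReal 0 (‖u‖ ^ 2 + b ^ 2).toNNReal := by
  have h1 : ((gaussE n).prod (gaussianReal 0 1)).map (fun p => ⟪u, p.1⟫)
      = gaussianReal 0 (‖u‖ ^ 2).toNNReal := by
    have h := Measure.map_map (μ := (gaussE n).prod (gaussianReal 0 1))
      (g := fun y : En n => ⟪u, y⟫) (by fun_prop) measurable_fst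
    rw [Measure.map_fst_prod, measure_univ, one_smul, map_inner_gaussE] at h
    exact h.symm
  have h2 : ((gaussE n).prod (gaussianReal 0 1)).map (fun p => b * p.2)
      = gaussianReal 0 (b ^ 2).toNNReal := by
    have h := Measure.map_map (μ := (gaussE n).prod (gaussianReal 0 1))
      (g := fun z : ℝ => b * z) (by fun_prop) measurable_snd
    rw [Measure.map_snd_prod, measure_univ, one_smul, gaussianReal_map_const_mul, mul_zero,
      mul_one, ← Real.toNNReal_of_nonneg] at h
    exact h.symm
  have h := gaussianReal_add_gaussianReal_of_indepFun
    (indepFun_prod (μ := gaussE n) (ν := gaussianReal 0 1) (X := fun y => ⟪u, y⟫)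
      (Y := fun z => b * z) (by fun_prop) (by fun_prop)) h1 h2
  rw [Real.toNNReal_add (sq_nonneg _) (sq_nonneg _)]
  rw [add_zero] at h
  exact h

lemma integral_inner_gaussE (u : En n) : ∫ y, ⟪u, y⟫ ∂(gaussE n) = 0 := by
  rw [gaussE_eq_stdGaussian]
  exact integral_strongDual_stdGaussian (innerSL ℝ u)

lemma ae_eq_zero_of_integral_eq_zero {g : En n → ℝ} (hg : Measurable g)
    (h01 : ∀ y, g y ∈ Set.Icc (0 : ℝ) 1) (h : ∫ y, g y ∂(gaussE n) = 0) :
    g =ᵐ[gaussE n] 0 :=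
  (integral_eq_zero_iff_of_nonneg (fun y => (h01 y).1) (integrable_of_mem_Icc hg h01)).1 h

lemma ae_eq_one_of_integral_eq_one {g : En n → ℝ} (hg : Measurable g)
    (h01 : ∀ y, g y ∈ Set.Icc (0 : ℝ) 1) (h : ∫ y, g y ∂(gaussE n) = 1) :
    g =ᵐ[gaussE n] 1 := by
  have h' : ∫ y, (1 - g y) ∂(gaussE n) = 0 := by
    rw [integral_sub (integrable_const 1) (integrable_of_mem_Icc hg h01), h]
    simp
  filter_upwards [ae_eq_zero_of_integral_eq_zero (g := fun y => 1 - g y)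
    (measurable_const.sub hg) (fun y => ⟨sub_nonneg.2 (h01 y).2, sub_le_self _ (h01 y).1⟩) h']
    with y hy
  exact (sub_eq_zero.1 hy).symm

lemma integral_mem_Icc {g : En n → ℝ} (hg : Measurable g)
    (h01 : ∀ y, g y ∈ Set.Icc (0 : ℝ) 1) : ∫ y, g y ∂(gaussE n) ∈ Set.Icc (0 : ℝ) 1 := by
  refine ⟨integral_nonneg fun y => (h01 y).1, ?_⟩
  simpa using integral_mono (integrable_of_mem_Icc hg h01) (integrable_const (1 : ℝ))
    fun y => (h01 y).2

lemma integral_inner_add_mul_integral_Igauss_le_of_unit {g : En n → ℝ} (hg : Measurable g)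
    (h01 : ∀ y, g y ∈ Set.Icc (0 : ℝ) 1) {u : En n} {b : ℝ} (hub : ‖u‖ ^ 2 + b ^ 2 = 1) :
    ∫ y, g y * ⟪u, y⟫ ∂(gaussE n) + b * ∫ y, Igauss (g y) ∂(gaussE n)
      ≤ Igauss (∫ y, g y ∂(gaussE n)) := by
  have hm := integral_mem_Icc hg h01
  have hig := integrable_of_mem_Icc hg h01
  rcases hm.1.eq_or_lt with h0 | h0
  · have hae := ae_eq_zero_of_integral_eq_zero hg h01 h0.symm
    rw [← h0, integral_eq_zero_of_ae (hae.mono fun y hy => by simp [hy]),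
      integral_eq_zero_of_ae (hae.mono fun y hy => by simp [hy, Igauss])]
    simp [Igauss]
  rcases hm.2.eq_or_lt with h1 | h1
  · have hae := ae_eq_one_of_integral_eq_one hg h01 h1
    rw [h1, integral_congr_ae (g := fun y => ⟪u, y⟫) (hae.mono fun y hy => by simp [hy]),
      integral_inner_gaussE,
      integral_eq_zero_of_ae (hae.mono fun y hy => by simp [hy, Igauss])]
    simp [Igauss]
  set m := ∫ y, g y ∂(gaussE n)
  set q := gaussQuantile m
  have hcont : Continuous fun w : ℝ => max (w + q) 0 := by fun_prop
  have hint1 : Integrable (fun w => max (w + q) 0) (gaussianReal 0 1) :=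
    (integrable_id_gaussianReal.add (integrable_const q)).pos_part
  have hmap : ((gaussE n).prod (gaussianReal 0 1)).map (fun p => ⟪u, p.1⟫ + b * p.2)
      = gaussianReal 0 1 := by
    rw [map_inner_add_gaussE_prod, hub, Real.toNNReal_one]
  have hX : Measurable fun p : En n × ℝ => ⟪u, p.1⟫ + b * p.2 := by fun_prop
  have hint : Integrable (fun p : En n × ℝ => max (⟪u, p.1⟫ + b * p.2 + q) 0)
      ((gaussE n).prod (gaussianReal 0 1)) := by
    rw [← hmap] at hint1
    exact hint1.comp_measurable hX
  have hval : ∫ y, ∫ z, max (⟪u, y⟫ + b * z + q) 0 ∂(gaussianReal 0 1) ∂(gaussE n)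
      = Igauss m + q * m := by
    rw [← integral_pos_part_add_gaussQuantile h0 h1, ← integral_prod _ hint]
    have h := integral_map hX.aemeasurable hcont.aestronglyMeasurable
      (μ := (gaussE n).prod (gaussianReal 0 1))
    rw [hmap] at h
    exact h.symm
  calc ∫ y, g y * ⟪u, y⟫ ∂(gaussE n) + b * ∫ y, Igauss (g y) ∂(gaussE n)
      = ∫ y, (g y * ⟪u, y⟫ + b * Igauss (g y)) ∂(gaussE n) := by
        rw [integral_add (integrable_mul_inner hg h01 u)
          ((integrable_Igauss_comp hg).const_mul b), integral_const_mul]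
    _ ≤ ∫ y, (∫ z, max (⟪u, y⟫ + b * z + q) 0 ∂(gaussianReal 0 1) - q * g y) ∂(gaussE n) := by
        refine integral_mono ((integrable_mul_inner hg h01 u).add
          ((integrable_Igauss_comp hg).const_mul b))
          (hint.integral_prod_left.sub (hig.const_mul q)) fun y => ?_
        have h := mul_add_mul_Igauss_le_integral (h01 y) (⟪u, y⟫ + q) b
        simp_rw [add_right_comm _ q] at h
        simp only
        linarith
    _ = Igauss m := by
        rw [integral_sub hint.integral_prod_left (hig.const_mul q), hval, integral_const_mul]
        ring

lemma sq_add_sq_le_Igauss_sq {g : En n → ℝ} (hg : Measurable g)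
    (h01 : ∀ y, g y ∈ Set.Icc (0 : ℝ) 1) {u : En n}
    (hu : ∫ y, g y * ⟪u, y⟫ ∂(gaussE n) = ‖u‖ ^ 2) :
    ‖u‖ ^ 2 + (∫ y, Igauss (g y) ∂(gaussE n)) ^ 2 ≤ Igauss (∫ y, g y ∂(gaussE n)) ^ 2 := by
  set B := ∫ y, Igauss (g y) ∂(gaussE n) with hB
  rcases (add_nonneg (sq_nonneg ‖u‖) (sq_nonneg B)).eq_or_lt with h0 | hpos
  · rw [← h0]
    positivity
  set s := Real.sqrt (‖u‖ ^ 2 + B ^ 2)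
  have hs0 : 0 < s := Real.sqrt_pos.2 hpos
  have hs2 : s ^ 2 = ‖u‖ ^ 2 + B ^ 2 := Real.sq_sqrt hpos.le
  have h := integral_inner_add_mul_integral_Igauss_le_of_unit hg h01 (u := s⁻¹ • u)
    (b := s⁻¹ * B) (by
      rw [norm_smul, mul_pow, mul_pow, norm_inv, Real.norm_of_nonneg hs0.le, ← mul_add, ← hs2]
      field_simp)
  simp_rw [real_inner_smul_left, mul_left_comm _ s⁻¹] at h
  rw [integral_const_mul, hu, ← hB] at h
  have h' : s ≤ Igauss (∫ y, g y ∂(gaussE n)) := by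
    refine le_trans (le_of_eq ?_) h
    field_simp
    linarith
  rw [← hs2]
  exact pow_le_pow_left₀ hs0.le h' 2

lemma hasDerivAt_integral_comp_add_gaussE {g : En n → ℝ} (hg : Measurable g)
    (h01 : ∀ y, g y ∈ Set.Icc (0 : ℝ) 1) (w : En n) :
    HasDerivAt (fun s : ℝ => ∫ y, g (y + s • w) ∂(gaussE n))
      (∫ y, g y * ⟪w, y⟫ ∂(gaussE n)) 0 := by
  set μ := (gaussE n).withDensity fun y => ENNReal.ofReal (g y) with hμ
  have hintμ : ∀ h : En n → ℝ, ∫ y, h y ∂μ = ∫ y, g y * h y ∂(gaussE n) := fun h => by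
    rw [hμ, integral_withDensity_eq_integral_toReal_smul (by fun_prop) (by simp)]
    simp only [ENNReal.toReal_ofReal (h01 _).1, smul_eq_mul]
  have hle : μ ≤ gaussE n := by
    have h := withDensity_mono (μ := gaussE n) (f := fun y => ENNReal.ofReal (g y)) (g := 1)
      (.of_forall fun y => by simpa using (h01 y).2)
    rwa [withDensity_one] at h
  have hexp : integrableExpSet (fun y => ⟪w, y⟫) μ = Set.univ := by
    refine Set.eq_univ_of_forall fun s => Integrable.mono_measure ?_ hle
    have h := integrable_exp_mul_gaussianReal (μ := 0) (v := (‖w‖ ^ 2).toNNReal) s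
    rw [← map_inner_gaussE w] at h
    exact h.comp_measurable (by fun_prop)
  have hmgf := hasDerivAt_mgf (X := fun y => ⟪w, y⟫) (μ := μ) (t := 0) (by simp [hexp])
  have hquad : HasDerivAt (fun s : ℝ => Real.exp (-(s ^ 2 * ‖w‖ ^ 2 / 2))) 0 0 := by
    have h := (((hasDerivAt_pow 2 (0 : ℝ)).mul_const (‖w‖ ^ 2)).div_const 2).neg.exp
    simpa using h
  have hprod := hmgf.mul hquad
  rw [hintμ] at hprod
  simp only [zero_mul, Real.exp_zero, mul_one, mul_zero, add_zero, ne_eq, OfNat.ofNat_ne_zero,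
    not_false_eq_true, zero_pow, zero_div, neg_zero] at hprod
  convert! hprod using 1
  ext s
  rw [integral_add_gaussE, Pi.mul_apply, mgf, hintμ, ← integral_mul_const]
  refine integral_congr_ae (.of_forall fun y => ?_)
  simp only
  rw [mul_assoc, ← Real.exp_add, real_inner_smul_left, norm_smul, mul_pow, Real.norm_eq_abs,
    sq_abs, sub_eq_add_neg]

end GaussianMeasure

section OrnsteinUhlenbeck

variable {n : ℕ}

lemma one_sub_exp_pos {t : ℝ} (ht : 0 < t) : 0 < 1 - Real.exp (-2 * t) :=
  sub_pos.2 (Real.exp_lt_one_iff.2 (by linarith))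

lemma measurable_comp_affine {f : En n → ℝ} (hf : Measurable f) (a σ : ℝ) (x : En n) :
    Measurable fun y => f (a • x + σ • y) :=
  hf.comp (by fun_prop)

lemma ou_add (f : En n → ℝ) {t : ℝ} (ht : 0 < t) (x v : En n) :
    ou n t f (x + v) = ∫ y, f (Real.exp (-t) • x + Real.sqrt (1 - Real.exp (-2 * t)) •
      (y + (Real.exp (-t) / Real.sqrt (1 - Real.exp (-2 * t))) • v)) ∂(gaussE n) := by
  have hσ : Real.sqrt (1 - Real.exp (-2 * t)) ≠ 0 := (Real.sqrt_pos.2 (one_sub_exp_pos ht)).ne'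
  refine integral_congr_ae (.of_forall fun y => congrArg f ?_)
  simp only [smul_add, smul_smul, mul_div_cancel₀ _ hσ]
  abel

lemma norm_gradient_ou_sq {f : En n → ℝ} (hf : Measurable f)
    (h01 : ∀ x, f x ∈ Set.Icc (0 : ℝ) 1) {t : ℝ} (ht : 0 < t) (x : En n) :
    ‖gradient (ou n t f) x‖ ^ 2 = Real.exp (-t) / Real.sqrt (1 - Real.exp (-2 * t)) *
      ∫ y, f (Real.exp (-t) • x + Real.sqrt (1 - Real.exp (-2 * t)) • y) *
        ⟪gradient (ou n t f) x, y⟫ ∂(gaussE n) := by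
  by_cases hd : DifferentiableAt ℝ (ou n t f) x
  swap
  · simp [gradient_eq_zero_of_not_differentiableAt hd]
  set G := gradient (ou n t f) x
  set k := Real.exp (-t) / Real.sqrt (1 - Real.exp (-2 * t))
  have h1 : HasDerivAt (fun s : ℝ => ou n t f (x + s • G)) ⟪G, G⟫ 0 := by
    have hF := hd.hasGradientAt.hasFDerivAt
    have hl : HasDerivAt (fun s : ℝ => x + s • G) G 0 := by
      simpa using ((hasDerivAt_id (0 : ℝ)).smul_const G).const_add x
    exact HasFDerivAt.comp_hasDerivAt_of_eq 0 hF hl (by simp)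
  have h2 := hasDerivAt_integral_comp_add_gaussE
    (measurable_comp_affine hf (Real.exp (-t)) (Real.sqrt (1 - Real.exp (-2 * t))) x)
    (fun y => h01 _) (k • G)
  have h3 : (fun s : ℝ => ou n t f (x + s • G)) = fun s : ℝ =>
      ∫ y, f (Real.exp (-t) • x + Real.sqrt (1 - Real.exp (-2 * t)) • (y + s • k • G))
        ∂(gaussE n) := by
    ext s
    rw [ou_add f ht, smul_comm]
  rw [h3] at h1
  rw [← real_inner_self_eq_norm_sq, h1.unique h2, ← integral_const_mul]
  simp_rw [real_inner_smul_left, mul_left_comm _ k]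

lemma exp_sub_one_mul_sq {t : ℝ} (ht : 0 < t) :
    (Real.exp (2 * t) - 1) * (Real.exp (-t) / Real.sqrt (1 - Real.exp (-2 * t))) ^ 2 = 1 := by
  have h := one_sub_exp_pos ht
  rw [div_pow, Real.sq_sqrt h.le, ← Real.exp_nat_mul, ← mul_div_assoc, div_eq_one_iff_eq h.ne',
    sub_mul, ← Real.exp_add]
  push_cast
  ring_nf
  simp

lemma ou_gradient_bound {f : En n → ℝ} (hf : Measurable f)
    (h01 : ∀ x, f x ∈ Set.Icc (0 : ℝ) 1) {t : ℝ} (ht : 0 < t) (x : En n) :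
    (Real.exp (2 * t) - 1) * ‖gradient (ou n t f) x‖ ^ 2 ≤
      (Igauss (ou n t f x)) ^ 2 - (ou n t (fun y => Igauss (f y)) x) ^ 2 := by
  have hgrad := norm_gradient_ou_sq hf h01 ht x
  have hone := exp_sub_one_mul_sq ht
  set G := gradient (ou n t f) x
  set k := Real.exp (-t) / Real.sqrt (1 - Real.exp (-2 * t))
  have hk0 : 0 < k := div_pos (Real.exp_pos _) (Real.sqrt_pos.2 (one_sub_exp_pos ht))
  have hnorm : ‖k⁻¹ • G‖ ^ 2 = (Real.exp (2 * t) - 1) * ‖G‖ ^ 2 := by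
    rw [norm_smul, mul_pow, norm_inv, Real.norm_of_nonneg hk0.le, inv_pow,
      inv_eq_of_mul_eq_one_left hone]
  have h := sq_add_sq_le_Igauss_sq
    (measurable_comp_affine hf (Real.exp (-t)) (Real.sqrt (1 - Real.exp (-2 * t))) x)
    (fun y => h01 _) (u := k⁻¹ • G) (by
      simp_rw [real_inner_smul_left, mul_left_comm _ k⁻¹]
      rw [integral_const_mul, norm_smul, mul_pow, hgrad, norm_inv, Real.norm_of_nonneg hk0.le]
      field_simp)
  rw [hnorm] at h
  exact le_sub_iff_add_le.2 h

lemma ou_mem_Icc {f : En n → ℝ} (hf : Measurable f) (h01 : ∀ x, f x ∈ Set.Icc (0 : ℝ) 1)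
    (t : ℝ) (x : En n) : ou n t f x ∈ Set.Icc (0 : ℝ) 1 :=
  integral_mem_Icc (measurable_comp_affine hf _ _ x) fun _ => h01 _

lemma ou_eq_of_ae_eq_const {f : En n → ℝ} {t : ℝ} (ht : 0 < t) {x : En n} {c : ℝ}
    (h : (fun y => f (Real.exp (-t) • x + Real.sqrt (1 - Real.exp (-2 * t)) • y))
      =ᵐ[gaussE n] fun _ => c) (x' : En n) : ou n t f x' = c := by
  have h1 := integral_add_gaussE
    (fun y => f (Real.exp (-t) • x + Real.sqrt (1 - Real.exp (-2 * t)) • y))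
    ((Real.exp (-t) / Real.sqrt (1 - Real.exp (-2 * t))) • (x' - x))
  rw [← ou_add f ht, add_sub_cancel] at h1
  rw [h1, integral_congr_ae (g := fun y => c * _) (h.mono fun y hy => by simp only [hy]; rfl),
    ← integral_add_gaussE (fun _ => c)]
  simp

lemma ou_trichotomy {f : En n → ℝ} (hf : Measurable f) (h01 : ∀ x, f x ∈ Set.Icc (0 : ℝ) 1)
    {t : ℝ} (ht : 0 < t) :
    (∀ x, ou n t f x = 0) ∨ (∀ x, ou n t f x = 1) ∨ ∀ x, ou n t f x ∈ Set.Ioo (0 : ℝ) 1 := by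
  by_cases h0 : ∃ x, ou n t f x = 0
  · obtain ⟨x, hx⟩ := h0
    exact .inl <| ou_eq_of_ae_eq_const ht <| ae_eq_zero_of_integral_eq_zero
      (measurable_comp_affine hf _ _ x) (fun _ => h01 _) hx
  by_cases h1 : ∃ x, ou n t f x = 1
  · obtain ⟨x, hx⟩ := h1
    exact .inr <| .inl <| ou_eq_of_ae_eq_const ht <| ae_eq_one_of_integral_eq_one
      (measurable_comp_affine hf _ _ x) (fun _ => h01 _) hx
  push Not at h0 h1
  exact .inr <| .inr fun x => ⟨(ou_mem_Icc hf h01 t x).1.lt_of_ne' (h0 x),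
    (ou_mem_Icc hf h01 t x).2.lt_of_ne (h1 x)⟩

lemma gradient_quantile_ou_bound {f : En n → ℝ} (hf : Measurable f)
    (h01 : ∀ x, f x ∈ Set.Icc (0 : ℝ) 1) {t : ℝ} (ht : 0 < t) (x : En n) :
    ‖gradient (fun y => gaussQuantile (ou n t f y)) x‖ ^ 2 ≤ 1 / (Real.exp (2 * t) - 1) := by
  have hpos : 0 < Real.exp (2 * t) - 1 := sub_pos.2 (Real.one_lt_exp_iff.2 (by linarith))
  rcases ou_trichotomy hf h01 ht with h | h | h
  · simp only [h, gradient_fun_const]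
    simpa using hpos.le
  · simp only [h, gradient_fun_const]
    simpa using hpos.le
  set H := fun y => gaussQuantile (ou n t f y)
  by_cases hd : DifferentiableAt ℝ H x
  swap
  · simpa [gradient_eq_zero_of_not_differentiableAt hd] using hpos.le
  have hcomp : ou n t f = gaussCdf ∘ H :=
    funext fun y => (gaussCdf_gaussQuantile (h y).1 (h y).2).symm
  have hgrad : HasGradientAt (ou n t f) (gaussPdf (H x) • gradient H x) x := by
    rw [hcomp, hasGradientAt_iff_hasFDerivAt, map_smul]
    exact (hasDerivAt_gaussCdf (H x)).comp_hasFDerivAt x hd.hasGradientAt.hasFDerivAt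
  have hmain := ou_gradient_bound hf h01 ht x
  have hφ := gaussPdf_pos (H x)
  rw [hgrad.gradient, Igauss_eq (h x).1 (h x).2, norm_smul, mul_pow,
    Real.norm_of_nonneg hφ.le] at hmain
  rw [le_div_iff₀ hpos]
  have hle : gaussPdf (H x) ^ 2 * (‖gradient H x‖ ^ 2 * (Real.exp (2 * t) - 1))
      ≤ gaussPdf (H x) ^ 2 * 1 := by
    have := sq_nonneg (ou n t (fun y => Igauss (f y)) x)
    change _ ≤ gaussPdf (H x) ^ 2 - _ at hmain
    linarith
  exact le_of_mul_le_mul_left hle (pow_pos hφ 2)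

end OrnsteinUhlenbeck

/-- Reverse isoperimetric inequality along the Ornstein–Uhlenbeck
semigroup, and the resulting Lipschitz bound on `Φ⁻¹ ∘ Q_t f`. -/
theorem reverse_isoperimetric_ou {n : ℕ} (f : En n → ℝ)
    (hmeas : Measurable f) (h01 : ∀ x, f x ∈ Set.Icc (0 : ℝ) 1)
    (t : ℝ) (ht : 0 < t) (x : En n) :
    (Real.exp (2 * t) - 1) * ‖gradient (ou n t f) x‖ ^ 2 ≤
        (Igauss (ou n t f x)) ^ 2 - (ou n t (fun y => Igauss (f y)) x) ^ 2 ∧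
    ‖gradient (fun y => gaussQuantile (ou n t f y)) x‖ ^ 2 ≤ 1 / (Real.exp (2 * t) - 1) := by
  exact ⟨ou_gradient_bound hmeas h01 ht x, gradient_quantile_ou_bound hmeas h01 ht x⟩
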